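/- Let λ : Fin n → ℕ and μ : Fin n → ℕ be partitions, let I be any finite word of indices, and let r be a reduced word for the order-reversing permutation w0 ∈ S_n (so that π_r(x^λ) is the Schur polynomial s_λ(x_1, …, x_n)). Then the product π_I(x^μ) * π_r(x^λ) (the product of a key polynomial and a Schur polynomial) is atom-positive. -/

import Mathlib

open MvPolynomial

noncomputable section

/-- Valid indices: `i` with `i + 1 < n`. -/
abbrev Idx (n : ℕ) := {i : ℕ // i + 1 < n}

/-- The element `i` of `Fin n`. -/
def idxLow {n : ℕ} (i : Idx n) : Fin n := ⟨i.1, Nat.lt_of_succ_lt i.2⟩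

/-- The element `i + 1` of `Fin n`. -/
def idxHigh {n : ℕ} (i : Idx n) : Fin n := ⟨i.1 + 1, i.2⟩

/-- The simple transposition `s_i = (i, i+1)` in `S_n`. -/
def simpleT {n : ℕ} (i : Idx n) : Equiv.Perm (Fin n) := Equiv.swap (idxLow i) (idxHigh i)

/-- The action of `s_i` on polynomials, renaming the variables `X i` and `X (i+1)`. -/
def sOp {n : ℕ} (i : Idx n) (f : MvPolynomial (Fin n) ℤ) : MvPolynomial (Fin n) ℤ :=
  rename ⇑(simpleT i) f

/-- The type of families of operators indexed by valid indices. -/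
abbrev DD (n : ℕ) := Idx n → MvPolynomial (Fin n) ℤ → MvPolynomial (Fin n) ℤ

/-- `D` is the family of divided difference operators `∂_i`:
`(X i − X (i+1)) * ∂_i f = f − s_i f` (this determines `∂_i f` uniquely since
`MvPolynomial (Fin n) ℤ` is an integral domain). -/
def IsDividedDiff {n : ℕ} (D : DD n) : Prop :=
  ∀ (i : Idx n) (f : MvPolynomial (Fin n) ℤ),
    (X (idxLow i) - X (idxHigh i)) * D i f = f - sOp i f

/-- `π_i f = ∂_i (X i * f)`. -/
def piOp {n : ℕ} (D : DD n) (i : Idx n) (f : MvPolynomial (Fin n) ℤ) :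
    MvPolynomial (Fin n) ℤ :=
  D i (X (idxLow i) * f)

/-- `θ_i f = X (i+1) * ∂_i f`. -/
def thetaOp {n : ℕ} (D : DD n) (i : Idx n) (f : MvPolynomial (Fin n) ℤ) :
    MvPolynomial (Fin n) ℤ :=
  X (idxHigh i) * D i f

/-- `θ_w = θ_{i_1} ∘ ⋯ ∘ θ_{i_k}` for a word `w = (i_1, …, i_k)`. -/
def thetaWord {n : ℕ} (D : DD n) : List (Idx n) → MvPolynomial (Fin n) ℤ → MvPolynomial (Fin n) ℤ
  | [], f => f
  | i :: w, f => thetaOp D i (thetaWord D w f)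

/-- `π_w = π_{i_1} ∘ ⋯ ∘ π_{i_k}` for a word `w = (i_1, …, i_k)`. -/
def piWord {n : ℕ} (D : DD n) : List (Idx n) → MvPolynomial (Fin n) ℤ → MvPolynomial (Fin n) ℤ
  | [], f => f
  | i :: w, f => piOp D i (piWord D w f)

/-- The permutation `s_{i_1} · ⋯ · s_{i_k}` represented by a word. -/
def wordProd {n : ℕ} (w : List (Idx n)) : Equiv.Perm (Fin n) := (w.map simpleT).prod

/-- `w` is a reduced word for `σ`: it represents `σ` and no shorter word does. -/
def IsReducedWord {n : ℕ} (w : List (Idx n)) (σ : Equiv.Perm (Fin n)) : Prop :=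
  wordProd w = σ ∧ ∀ w' : List (Idx n), wordProd w' = σ → w.length ≤ w'.length

/-- The length `l(σ)`: the length of any reduced word for `σ`. -/
def len {n : ℕ} (σ : Equiv.Perm (Fin n)) : ℕ :=
  sInf {k | ∃ w : List (Idx n), wordProd w = σ ∧ w.length = k}

/-- Strong Bruhat order: some reduced word of `γ` is a (not necessarily contiguous)
subword of some reduced word of `σ`. -/
def BruhatLE {n : ℕ} (γ σ : Equiv.Perm (Fin n)) : Prop :=
  ∃ u v : List (Idx n), IsReducedWord u γ ∧ IsReducedWord v σ ∧ u.Sublist v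

/-- The monomial `x^λ = ∏ j, (X j)^(λ j)`. -/
def xpow {n : ℕ} (lam : Fin n → ℕ) : MvPolynomial (Fin n) ℤ := ∏ j, X j ^ lam j

/-- `f` is atom-positive: it lies in the additive submonoid generated by the
Demazure atoms `θ_w (x^λ)` with `w` a reduced word and `λ` a partition. -/
def AtomPos {n : ℕ} (D : DD n) (f : MvPolynomial (Fin n) ℤ) : Prop :=
  f ∈ AddSubmonoid.closure {g : MvPolynomial (Fin n) ℤ |
    ∃ (w : List (Idx n)) (σ : Equiv.Perm (Fin n)) (lam : Fin n → ℕ),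
      IsReducedWord w σ ∧ Antitone lam ∧ g = thetaWord D w (xpow lam)}

/-- `f` is key-positive: it lies in the additive submonoid generated by the
key polynomials `π_w (x^λ)` with `w` a word and `λ` a partition. -/
def KeyPos {n : ℕ} (D : DD n) (f : MvPolynomial (Fin n) ℤ) : Prop :=
  f ∈ AddSubmonoid.closure {g : MvPolynomial (Fin n) ℤ |
    ∃ (w : List (Idx n)) (lam : Fin n → ℕ),
      Antitone lam ∧ g = piWord D w (xpow lam)}

/-- The number of inversions of a permutation. -/
def invNum {n : ℕ} (σ : Equiv.Perm (Fin n)) : ℕ :=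
  (Finset.univ.filter (fun p : Fin n × Fin n => p.1 < p.2 ∧ σ p.2 < σ p.1)).card

end

/-! ### Permutations, inversions and reduced words -/

theorem idxLow_lt_idxHigh {n : ℕ} (i : Idx n) : idxLow i < idxHigh i := by
  simp [Fin.lt_def, idxLow, idxHigh]

theorem simpleT_low {n : ℕ} (i : Idx n) : simpleT i (idxLow i) = idxHigh i :=
  Equiv.swap_apply_left _ _

theorem simpleT_high {n : ℕ} (i : Idx n) : simpleT i (idxHigh i) = idxLow i :=
  Equiv.swap_apply_right _ _

theorem simpleT_apply_of_ne {n : ℕ} (i : Idx n) {x : Fin n} (h₁ : x ≠ idxLow i)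
    (h₂ : x ≠ idxHigh i) : simpleT i x = x :=
  Equiv.swap_apply_of_ne_of_ne h₁ h₂

theorem simpleT_simpleT {n : ℕ} (i : Idx n) (x : Fin n) : simpleT i (simpleT i x) = x :=
  Equiv.swap_apply_self _ _ _

theorem simpleT_mul_self {n : ℕ} (i : Idx n) : simpleT i * simpleT i = 1 :=
  Equiv.swap_mul_self _ _

theorem simpleT_inv {n : ℕ} (i : Idx n) : (simpleT i)⁻¹ = simpleT i :=
  Equiv.swap_inv _ _

/-- A simple transposition preserves the order of all pairs but one. -/
theorem simpleT_lt {n : ℕ} (i : Idx n) {x y : Fin n} (h : x < y)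
    (hne : ¬(x = idxLow i ∧ y = idxHigh i)) : simpleT i x < simpleT i y := by
  unfold simpleT
  rw [Equiv.swap_apply_def, Equiv.swap_apply_def]
  simp only [idxLow, idxHigh, Fin.lt_def, Fin.ext_iff] at *
  split_ifs <;> (try simp only) <;> omega

theorem invNum_mul_simpleT {n : ℕ} (σ : Equiv.Perm (Fin n)) (i : Idx n)
    (h : σ (idxLow i) < σ (idxHigh i)) : invNum (σ * simpleT i) = invNum σ + 1 := by
  classical
  unfold invNum
  set S := Finset.univ.filter (fun p : Fin n × Fin n => p.1 < p.2 ∧ σ p.2 < σ p.1) with hS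
  have key : Finset.univ.filter (fun p : Fin n × Fin n =>
      p.1 < p.2 ∧ (σ * simpleT i) p.2 < (σ * simpleT i) p.1)
      = insert (idxLow i, idxHigh i)
        (S.map ((simpleT i).prodCongr (simpleT i)).toEmbedding) := by
    ext ⟨x, y⟩
    rw [Finset.mem_filter, Finset.mem_insert, Finset.mem_map]
    simp only [Finset.mem_filter, Finset.mem_univ, true_and, hS, Prod.mk.injEq, Equiv.Perm.mul_apply,
      Prod.exists, Equiv.coe_toEmbedding,
      Equiv.prodCongr_apply, Prod.map_apply]
    constructor
    · rintro ⟨hxy, hσ⟩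
      by_cases hne : x = idxLow i ∧ y = idxHigh i
      · exact Or.inl hne
      · exact Or.inr ⟨simpleT i x, simpleT i y, ⟨simpleT_lt i hxy hne, hσ⟩,
          simpleT_simpleT _ _, simpleT_simpleT _ _⟩
    · rintro (⟨rfl, rfl⟩ | ⟨u, v, ⟨huv, hσ⟩, rfl, rfl⟩)
      · rw [simpleT_low, simpleT_high]
        exact ⟨idxLow_lt_idxHigh i, h⟩
      · rw [simpleT_simpleT, simpleT_simpleT]
        refine ⟨simpleT_lt i huv ?_, hσ⟩
        rintro ⟨rfl, rfl⟩
        exact lt_asymm h hσ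
  rw [key, Finset.card_insert_of_notMem, Finset.card_map]
  simp only [Finset.mem_map, hS, Finset.mem_filter, Finset.mem_univ, true_and, Prod.exists,
    Equiv.coe_toEmbedding, Equiv.prodCongr_apply, Prod.map_apply, Prod.mk.injEq]
  rintro ⟨u, v, ⟨huv, -⟩, hu, hv⟩
  have hu' : u = idxHigh i := by rw [← simpleT_simpleT i u, hu, simpleT_low]
  have hv' : v = idxLow i := by rw [← simpleT_simpleT i v, hv, simpleT_high]
  subst hu' hv'
  exact lt_asymm huv (idxLow_lt_idxHigh i)

theorem invNum_mul_simpleT_of_gt {n : ℕ} (σ : Equiv.Perm (Fin n)) (i : Idx n)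
    (h : σ (idxHigh i) < σ (idxLow i)) : invNum (σ * simpleT i) + 1 = invNum σ := by
  have := invNum_mul_simpleT (σ * simpleT i) i (by
    simpa [Equiv.Perm.mul_apply, simpleT_low, simpleT_high] using h)
  rw [mul_assoc, simpleT_mul_self, mul_one] at this
  exact this.symm

theorem lt_or_gt_idx {n : ℕ} (σ : Equiv.Perm (Fin n)) (i : Idx n) :
    σ (idxLow i) < σ (idxHigh i) ∨ σ (idxHigh i) < σ (idxLow i) :=
  lt_or_gt_of_ne fun h => (idxLow_lt_idxHigh i).ne (σ.injective h)

theorem invNum_inv {n : ℕ} (σ : Equiv.Perm (Fin n)) : invNum σ⁻¹ = invNum σ := by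
  unfold invNum
  refine Finset.card_bij' (fun p _ => (σ⁻¹ p.2, σ⁻¹ p.1)) (fun p _ => (σ p.2, σ p.1))
    ?_ ?_ ?_ ?_ <;> simp +contextual

theorem invNum_one {n : ℕ} : invNum (1 : Equiv.Perm (Fin n)) = 0 := by
  unfold invNum
  rw [Finset.card_eq_zero, Finset.filter_eq_empty_iff]
  rintro ⟨x, y⟩ - ⟨h₁, h₂⟩
  exact lt_asymm h₁ h₂

theorem wordProd_nil {n : ℕ} : wordProd ([] : List (Idx n)) = 1 := rfl

theorem wordProd_cons {n : ℕ} (i : Idx n) (w : List (Idx n)) :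
    wordProd (i :: w) = simpleT i * wordProd w := by simp [wordProd]

theorem wordProd_append {n : ℕ} (u w : List (Idx n)) :
    wordProd (u ++ w) = wordProd u * wordProd w := by simp [wordProd]

theorem wordProd_singleton {n : ℕ} (i : Idx n) : wordProd [i] = simpleT i := by simp [wordProd]

theorem invNum_mul_simpleT_le {n : ℕ} (σ : Equiv.Perm (Fin n)) (i : Idx n) :
    invNum (σ * simpleT i) ≤ invNum σ + 1 := by
  rcases lt_or_gt_idx σ i with h | h
  · exact (invNum_mul_simpleT σ i h).le
  · have := invNum_mul_simpleT_of_gt σ i h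
    omega

theorem invNum_mul_wordProd_le {n : ℕ} (σ : Equiv.Perm (Fin n)) (w : List (Idx n)) :
    invNum (σ * wordProd w) ≤ invNum σ + w.length := by
  induction w generalizing σ with
  | nil => simp [wordProd_nil]
  | cons i w ih =>
    rw [wordProd_cons, ← mul_assoc, List.length_cons]
    have h₁ := ih (σ * simpleT i)
    have h₂ := invNum_mul_simpleT_le σ i
    omega

theorem invNum_wordProd_le {n : ℕ} (w : List (Idx n)) : invNum (wordProd w) ≤ w.length := by
  simpa [invNum_one] using invNum_mul_wordProd_le 1 w

/-- A relation that holds between neighbours and is transitive holds between all `x < y`. -/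
theorem rel_of_adjacent {n : ℕ} (r : Fin n → Fin n → Prop)
    (htrans : ∀ x y z, r x y → r y z → r x z) {x y : Fin n} (hxy : x < y)
    (h : ∀ i : Idx n, x ≤ idxLow i → idxHigh i ≤ y → r (idxLow i) (idxHigh i)) : r x y := by
  obtain ⟨x, hx⟩ := x
  obtain ⟨y, hy⟩ := y
  simp only [Fin.mk_lt_mk] at hxy
  induction y, hxy using Nat.le_induction with
  | base => exact h ⟨x, hy⟩ le_rfl le_rfl
  | succ y hxy ih =>
    refine htrans _ ⟨y, by omega⟩ _ (ih (by omega) fun i h₁ h₂ => h i h₁ (h₂.trans ?_))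
      (h ⟨y, hy⟩ ?_ le_rfl)
    · simp [Fin.le_def]
    · simp only [Fin.le_def, idxLow]
      omega

theorem eq_one_of_ascending {n : ℕ} (σ : Equiv.Perm (Fin n))
    (h : ∀ i, σ (idxLow i) < σ (idxHigh i)) : σ = 1 := by
  have hmono : StrictMono σ := fun x y hxy =>
    rel_of_adjacent (fun x y => σ x < σ y) (fun _ _ _ => lt_trans) hxy fun i _ _ => h i
  ext x
  have : (StrictMono.orderIsoOfSurjective σ hmono σ.surjective) = OrderIso.refl _ :=
    Subsingleton.elim _ _
  exact congrArg Fin.val (DFunLike.congr_fun this x)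

theorem exists_word {n : ℕ} (σ : Equiv.Perm (Fin n)) :
    ∃ w : List (Idx n), wordProd w = σ ∧ w.length = invNum σ := by
  induction hN : invNum σ generalizing σ with
  | zero =>
    refine ⟨[], (eq_one_of_ascending σ fun i => ?_).symm, rfl⟩
    rcases lt_or_gt_idx σ i with h | h
    · exact h
    · have := invNum_mul_simpleT_of_gt σ i h
      omega
  | succ N ih =>
    have : ∃ i, σ (idxHigh i) < σ (idxLow i) := by
      by_contra! hcon
      have : σ = 1 := eq_one_of_ascending σ fun i =>
        (lt_or_gt_idx σ i).resolve_right (hcon i).not_gt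
      rw [this, invNum_one] at hN
      omega
    obtain ⟨i, hi⟩ := this
    have h₁ := invNum_mul_simpleT_of_gt σ i hi
    obtain ⟨w, hw, hl⟩ := ih (σ * simpleT i) (by omega)
    refine ⟨w ++ [i], ?_, by simp [hl]⟩
    rw [wordProd_append, hw, wordProd_singleton, mul_assoc, simpleT_mul_self, mul_one]

theorem isReducedWord_iff {n : ℕ} {w : List (Idx n)} {σ : Equiv.Perm (Fin n)} :
    IsReducedWord w σ ↔ wordProd w = σ ∧ w.length = invNum σ := by
  constructor
  · rintro ⟨rfl, h⟩
    obtain ⟨w', hw', hl⟩ := exists_word (wordProd w)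
    exact ⟨rfl, le_antisymm (hl ▸ h w' hw') (invNum_wordProd_le w)⟩
  · rintro ⟨rfl, h⟩
    exact ⟨rfl, fun w' hw' => by rw [h, ← hw']; exact invNum_wordProd_le w'⟩

theorem exists_isReducedWord {n : ℕ} (σ : Equiv.Perm (Fin n)) : ∃ w, IsReducedWord w σ :=
  (exists_word σ).imp fun _ => isReducedWord_iff.2

theorem IsReducedWord.concat {n : ℕ} {w : List (Idx n)} {σ : Equiv.Perm (Fin n)}
    (hw : IsReducedWord w σ) {i : Idx n} (h : σ (idxLow i) < σ (idxHigh i)) :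
    IsReducedWord (w ++ [i]) (σ * simpleT i) := by
  rw [isReducedWord_iff] at *
  rw [wordProd_append, wordProd_singleton, hw.1, invNum_mul_simpleT σ i h]
  simp [hw.2]

theorem IsReducedWord.cons {n : ℕ} {w : List (Idx n)} {σ : Equiv.Perm (Fin n)}
    (hw : IsReducedWord w σ) {i : Idx n} (h : σ⁻¹ (idxLow i) < σ⁻¹ (idxHigh i)) :
    IsReducedWord (i :: w) (simpleT i * σ) := by
  rw [isReducedWord_iff] at *
  rw [wordProd_cons, hw.1, ← invNum_inv, mul_inv_rev, simpleT_inv,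
    invNum_mul_simpleT σ⁻¹ i h, invNum_inv]
  simp [hw.2]

/-- A reduced word ends in a right descent. -/
theorem IsReducedWord.of_concat {n : ℕ} {w : List (Idx n)} {i : Idx n}
    {σ : Equiv.Perm (Fin n)} (hw : IsReducedWord (w ++ [i]) σ) :
    IsReducedWord w (σ * simpleT i) ∧ σ (idxHigh i) < σ (idxLow i) := by
  rw [isReducedWord_iff] at *
  obtain ⟨rfl, hl⟩ := hw
  rw [wordProd_append, wordProd_singleton] at *
  have h₁ := invNum_wordProd_le w
  rw [List.length_append, List.length_singleton] at hl
  rcases lt_or_gt_idx (wordProd w) i with h | h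
  · have := invNum_mul_simpleT _ i h
    refine ⟨⟨by rw [mul_assoc, simpleT_mul_self, mul_one], ?_⟩, ?_⟩
    · rw [mul_assoc, simpleT_mul_self, mul_one]
      omega
    · simpa [Equiv.Perm.mul_apply, simpleT_low, simpleT_high] using h
  · have := invNum_mul_simpleT_of_gt _ i h
    omega

/-- The left factor of a reduced word is reduced. -/
theorem IsReducedWord.of_append {n : ℕ} {u v : List (Idx n)} {σ : Equiv.Perm (Fin n)}
    (hw : IsReducedWord (u ++ v) σ) : IsReducedWord u (wordProd u) := by
  rw [isReducedWord_iff] at *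
  obtain ⟨rfl, hl⟩ := hw
  rw [wordProd_append, List.length_append] at hl
  have h₁ := invNum_wordProd_le u
  have h₂ := invNum_mul_wordProd_le (wordProd u) v
  exact ⟨rfl, by omega⟩

theorem exists_concat_of_descent {n : ℕ} {σ : Equiv.Perm (Fin n)} {i : Idx n}
    (h : σ (idxHigh i) < σ (idxLow i)) :
    ∃ w, IsReducedWord w (σ * simpleT i) ∧ IsReducedWord (w ++ [i]) σ := by
  obtain ⟨w, hw⟩ := exists_isReducedWord (σ * simpleT i)
  refine ⟨w, hw, ?_⟩
  have := hw.concat (i := i) (by simpa [simpleT_low, simpleT_high] using h)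
  rwa [mul_assoc, simpleT_mul_self, mul_one] at this

theorem exists_cons_of_descent {n : ℕ} {σ : Equiv.Perm (Fin n)} {i : Idx n}
    (h : σ⁻¹ (idxHigh i) < σ⁻¹ (idxLow i)) :
    ∃ w, IsReducedWord w (simpleT i * σ) ∧ IsReducedWord (i :: w) σ := by
  obtain ⟨w, hw⟩ := exists_isReducedWord (simpleT i * σ)
  refine ⟨w, hw, ?_⟩
  have := hw.cons (i := i) (by simpa [simpleT_low, simpleT_high, simpleT_inv] using h)
  rwa [← mul_assoc, simpleT_mul_self, one_mul] at this

theorem simpleT_comm {n : ℕ} {i j : Idx n} (h : i.1 + 1 < j.1) :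
    simpleT i * simpleT j = simpleT j * simpleT i := by
  unfold simpleT
  refine (Equiv.Perm.disjoint_iff_disjoint_support.2 ?_).commute.eq
  rw [Equiv.Perm.support_swap (idxLow_lt_idxHigh i).ne,
    Equiv.Perm.support_swap (idxLow_lt_idxHigh j).ne]
  simp only [Finset.disjoint_insert_left, Finset.mem_insert, Finset.mem_singleton,
    Finset.disjoint_singleton_left, Fin.ext_iff, idxLow, idxHigh]
  omega

theorem simpleT_braid {n : ℕ} {i j : Idx n} (h : j.1 = i.1 + 1) :
    simpleT i * simpleT j * simpleT i = simpleT j * simpleT i * simpleT j := by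
  have e : idxHigh i = idxLow j := by simp [idxHigh, idxLow, h]
  have h₁ := (idxLow_lt_idxHigh i).ne
  have h₂ := (idxLow_lt_idxHigh j).ne
  have h₃ : idxLow i ≠ idxHigh j := ((idxLow_lt_idxHigh i).trans (e ▸ idxLow_lt_idxHigh j)).ne
  unfold simpleT
  rw [← e] at *
  rw [Equiv.swap_mul_swap_mul_swap h₁ h₃, Equiv.swap_comm (idxLow i),
    Equiv.swap_comm _ (idxHigh j), Equiv.swap_mul_swap_mul_swap h₂.symm h₃.symm,
    Equiv.swap_comm]

/-- Matsumoto's theorem for the symmetric group: a family satisfying the braid relations has the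
same product along all reduced words of a permutation. -/
theorem prod_map_eq_of_isReducedWord {n : ℕ} {M : Type*} [Monoid M] (T : Idx n → M)
    (hcomm : ∀ i j : Idx n, i.1 + 1 < j.1 → T i * T j = T j * T i)
    (hbraid : ∀ i j : Idx n, j.1 = i.1 + 1 → T i * T j * T i = T j * T i * T j)
    {w w' : List (Idx n)} {σ : Equiv.Perm (Fin n)} (hw : IsReducedWord w σ)
    (hw' : IsReducedWord w' σ) : (w.map T).prod = (w'.map T).prod := by
  induction hN : w.length using Nat.strong_induction_on generalizing w w' σ with
  | _ N ih =>
  have hlen := (isReducedWord_iff.1 hw).2.trans (isReducedWord_iff.1 hw').2.symm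
  have hfar : ∀ (i j : Idx n) (u v : List (Idx n)), i.1 + 1 < j.1 →
      IsReducedWord (u ++ [i]) σ → IsReducedWord (v ++ [j]) σ → u.length < N → v.length < N →
      (u.map T).prod * T i = (v.map T).prod * T j := by
    intro i j u v hij hu hv hul hvl
    obtain ⟨hu₁, hu₂⟩ := hu.of_concat
    obtain ⟨hv₁, hv₂⟩ := hv.of_concat
    have hd : (σ * simpleT i) (idxHigh j) < (σ * simpleT i) (idxLow j) := by
      rw [Equiv.Perm.mul_apply, Equiv.Perm.mul_apply, simpleT_apply_of_ne,
        simpleT_apply_of_ne]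
      · exact hv₂
      all_goals simp only [idxLow, idxHigh, ne_eq, Fin.ext_iff]; omega
    obtain ⟨t, ht, htj⟩ := exists_concat_of_descent hd
    have hti : IsReducedWord (t ++ [i]) (σ * simpleT j) := by
      have h := ht.concat (i := i) (by
        rw [mul_assoc, simpleT_comm hij, ← mul_assoc]
        simp only [Equiv.Perm.mul_apply, simpleT_low, simpleT_high]
        rw [simpleT_apply_of_ne, simpleT_apply_of_ne]
        · exact hu₂
        all_goals simp only [idxLow, idxHigh, ne_eq, Fin.ext_iff]; omega)
      rwa [mul_assoc σ, simpleT_comm hij, ← mul_assoc, mul_assoc _ (simpleT i),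
        simpleT_mul_self, mul_one] at h
    rw [ih _ hul hu₁ htj rfl, ih _ hvl hv₁ hti rfl]
    simp only [List.map_append, List.prod_append, List.map_singleton, List.prod_singleton]
    rw [mul_assoc, mul_assoc, hcomm i j hij]
  have hnear : ∀ (i j : Idx n) (u v : List (Idx n)), j.1 = i.1 + 1 →
      IsReducedWord (u ++ [i]) σ → IsReducedWord (v ++ [j]) σ → u.length < N → v.length < N →
      (u.map T).prod * T i = (v.map T).prod * T j := by
    intro i j u v hij hu hv hul hvl
    obtain ⟨hu₁, hu₂⟩ := hu.of_concat
    obtain ⟨hv₁, hv₂⟩ := hv.of_concat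
    have e₁ : idxHigh i = idxLow j := by simp [idxHigh, idxLow, hij]
    have e₂ : simpleT i (idxHigh j) = idxHigh j := simpleT_apply_of_ne i
      (by simp only [idxLow, idxHigh, ne_eq, Fin.ext_iff]; omega)
      (by simp only [idxHigh, ne_eq, Fin.ext_iff]; omega)
    have e₃ : simpleT j (idxLow i) = idxLow i := simpleT_apply_of_ne j
      (by simp only [idxLow, ne_eq, Fin.ext_iff]; omega)
      (by simp only [idxLow, idxHigh, ne_eq, Fin.ext_iff]; omega)
    have e₄ : simpleT i (idxLow j) = idxLow i := e₁ ▸ simpleT_high i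
    have e₅ : simpleT j (idxHigh i) = idxHigh j := e₁ ▸ simpleT_low j
    obtain ⟨t, ht⟩ := exists_isReducedWord (σ * (simpleT i * simpleT j * simpleT i))
    have hti := ht.concat (i := i) (by
      simp only [Equiv.Perm.mul_apply, simpleT_low, simpleT_high, e₃, e₅, e₂]
      rw [e₁]; exact hv₂)
    have htij := hti.concat (i := j) (by
      simp only [Equiv.Perm.mul_apply, e₂, e₄, e₅, simpleT_high, simpleT_low]
      exact hv₂.trans (e₁ ▸ hu₂))
    have htj := ht.concat (i := j) (by
      simp only [Equiv.Perm.mul_apply, e₂, e₄, simpleT_high, e₃, simpleT_low]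
      exact hu₂)
    have htji := htj.concat (i := i) (by
      rw [simpleT_braid hij]
      simp only [Equiv.Perm.mul_apply, simpleT_low, simpleT_high, e₃, e₅, e₄]
      exact hv₂.trans (e₁ ▸ hu₂))
    have q₁ : σ * (simpleT i * simpleT j * simpleT i) * simpleT i * simpleT j
        = σ * simpleT i := by
      simp [mul_assoc, simpleT_mul_self]
    have q₂ : σ * (simpleT i * simpleT j * simpleT i) * simpleT j * simpleT i
        = σ * simpleT j := by
      rw [simpleT_braid hij]
      simp only [mul_assoc, simpleT_mul_self, mul_one]
    rw [q₁] at htij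
    rw [q₂] at htji
    rw [ih _ hul hu₁ htij rfl, ih _ hvl hv₁ htji rfl]
    simp only [List.map_append, List.prod_append, List.map_singleton, List.prod_singleton]
    simp only [mul_assoc]
    rw [← mul_assoc (T i), hbraid i j hij, mul_assoc]
  rcases List.eq_nil_or_concat w with rfl | ⟨u, i, rfl⟩
  · rw [List.length_nil, eq_comm, List.length_eq_zero_iff] at hlen
    rw [hlen]
  rcases List.eq_nil_or_concat w' with rfl | ⟨v, j, rfl⟩
  · simp at hlen
  simp only [List.concat_eq_append] at hw hw' hlen hN ⊢
  simp only [List.length_append, List.length_singleton] at hlen hN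
  simp only [List.map_append, List.prod_append, List.map_singleton, List.prod_singleton]
  rcases lt_trichotomy i.1 j.1 with h | h | h
  · rcases Nat.lt_or_ge (i.1 + 1) j.1 with h' | h'
    · exact hfar i j u v h' hw hw' (by omega) (by omega)
    · exact hnear i j u v (by omega) hw hw' (by omega) (by omega)
  · obtain rfl : i = j := Subtype.ext h
    rw [ih _ (by omega) hw.of_concat.1 hw'.of_concat.1 rfl]
  · rcases Nat.lt_or_ge (j.1 + 1) i.1 with h' | h'
    · exact (hfar j i v u h' hw' hw (by omega) (by omega)).symm
    · exact (hnear j i v u (by omega) hw' hw (by omega) (by omega)).symm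

/-! ### Positive combinations in the 0-Hecke algebra -/

section Hecke

variable {n : ℕ} {E : Type*} [Ring E] {T : Idx n → E}

/-- Nonnegative combinations of the products of `T` along reduced words. -/
def heckeCone (T : Idx n → E) : AddSubmonoid E :=
  AddSubmonoid.closure {x | ∃ w σ, IsReducedWord w σ ∧ x = (w.map T).prod}

theorem prod_mem_heckeCone {w : List (Idx n)} {σ : Equiv.Perm (Fin n)} (hw : IsReducedWord w σ) :
    (w.map T).prod ∈ heckeCone T :=
  AddSubmonoid.subset_closure ⟨w, σ, hw, rfl⟩

theorem mul_one_add_mem_heckeCone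
    (hcomm : ∀ i j : Idx n, i.1 + 1 < j.1 → T i * T j = T j * T i)
    (hbraid : ∀ i j : Idx n, j.1 = i.1 + 1 → T i * T j * T i = T j * T i * T j)
    (hsq : ∀ i, T i * T i = -T i) {x : E} (hx : x ∈ heckeCone T) (i : Idx n) :
    x * (1 + T i) ∈ heckeCone T := by
  induction hx using AddSubmonoid.closure_induction with
  | mem x hx =>
    obtain ⟨w, σ, hw, rfl⟩ := hx
    rcases lt_or_gt_idx σ i with h | h
    · rw [mul_add, mul_one]
      refine add_mem (prod_mem_heckeCone hw) ?_
      simpa using prod_mem_heckeCone (T := T) (hw.concat h)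
    · obtain ⟨u, -, hu⟩ := exists_concat_of_descent h
      rw [prod_map_eq_of_isReducedWord T hcomm hbraid hw hu]
      simp [mul_assoc, mul_add, hsq]
  | zero => simp
  | add x y _ _ hx hy => rw [add_mul]; exact add_mem hx hy

theorem one_add_mul_mem_heckeCone
    (hcomm : ∀ i j : Idx n, i.1 + 1 < j.1 → T i * T j = T j * T i)
    (hbraid : ∀ i j : Idx n, j.1 = i.1 + 1 → T i * T j * T i = T j * T i * T j)
    (hsq : ∀ i, T i * T i = -T i) {x : E} (hx : x ∈ heckeCone T) (i : Idx n) :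
    (1 + T i) * x ∈ heckeCone T := by
  induction hx using AddSubmonoid.closure_induction with
  | mem x hx =>
    obtain ⟨w, σ, hw, rfl⟩ := hx
    rcases lt_or_gt_idx σ⁻¹ i with h | h
    · rw [add_mul, one_mul]
      refine add_mem (prod_mem_heckeCone hw) ?_
      simpa using prod_mem_heckeCone (T := T) (hw.cons h)
    · obtain ⟨u, -, hu⟩ := exists_cons_of_descent h
      rw [prod_map_eq_of_isReducedWord T hcomm hbraid hw hu]
      simp [← mul_assoc, add_mul, hsq]
  | zero => simp
  | add x y _ _ hx hy => rw [mul_add]; exact add_mem hx hy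

theorem mul_prod_one_add_mem_heckeCone
    (hcomm : ∀ i j : Idx n, i.1 + 1 < j.1 → T i * T j = T j * T i)
    (hbraid : ∀ i j : Idx n, j.1 = i.1 + 1 → T i * T j * T i = T j * T i * T j)
    (hsq : ∀ i, T i * T i = -T i) {x : E} (hx : x ∈ heckeCone T) (w : List (Idx n)) :
    x * (w.map fun i => 1 + T i).prod ∈ heckeCone T := by
  induction w generalizing x with
  | nil => simpa using hx
  | cons i w ih =>
    rw [List.map_cons, List.prod_cons, ← mul_assoc]
    exact ih (mul_one_add_mem_heckeCone hcomm hbraid hsq hx i)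

/-- `1 + T i` satisfies the braid relations if `T i` does and `T i ^ 2 = -T i`. -/
theorem one_add_comm (hcomm : ∀ i j : Idx n, i.1 + 1 < j.1 → T i * T j = T j * T i)
    (i j : Idx n) (h : i.1 + 1 < j.1) : (1 + T i) * (1 + T j) = (1 + T j) * (1 + T i) := by
  simp only [mul_add, add_mul, hcomm i j h, one_mul, mul_one]
  abel

theorem one_add_braid
    (hbraid : ∀ i j : Idx n, j.1 = i.1 + 1 → T i * T j * T i = T j * T i * T j)
    (hsq : ∀ i, T i * T i = -T i) (i j : Idx n) (h : j.1 = i.1 + 1) :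
    (1 + T i) * (1 + T j) * (1 + T i) = (1 + T j) * (1 + T i) * (1 + T j) := by
  simp only [mul_add, add_mul, hbraid i j h, hsq, one_mul, mul_one]
  abel

/-- `σ` is a minimal representative of its coset for the stabilizer of `ω`. -/
def BlockMono (ω : Fin n → ℕ) (σ : Equiv.Perm (Fin n)) : Prop :=
  ∀ x y, x < y → ω x = ω y → σ⁻¹ x < σ⁻¹ y

theorem BlockMono.of_mul {ω : Fin n → ℕ} {σ : Equiv.Perm (Fin n)} {i : Idx n}
    (hσ : BlockMono ω σ) (h : σ (idxHigh i) < σ (idxLow i)) : BlockMono ω (σ * simpleT i) := by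
  intro x y hxy hω
  rw [mul_inv_rev, simpleT_inv, Equiv.Perm.mul_apply, Equiv.Perm.mul_apply]
  refine simpleT_lt i (hσ x y hxy hω) ?_
  rintro ⟨h₁, h₂⟩
  rw [Equiv.Perm.inv_eq_iff_eq] at h₁ h₂
  rw [← h₁, ← h₂] at h
  exact lt_asymm h hxy

theorem exists_descent_of_not_blockMono {ω : Fin n → ℕ} (hω : Antitone ω)
    {σ : Equiv.Perm (Fin n)} (hσ : ¬BlockMono ω σ) :
    ∃ i : Idx n, ω (idxLow i) = ω (idxHigh i) ∧ σ⁻¹ (idxHigh i) < σ⁻¹ (idxLow i) := by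
  by_contra! hcon
  refine hσ fun x y hxy he => ?_
  refine rel_of_adjacent (fun x y => σ⁻¹ x < σ⁻¹ y) (fun _ _ _ => lt_trans) hxy fun i h₁ h₂ => ?_
  have h₃ := hω h₁
  have h₄ := hω h₂
  have h₅ := hω (idxLow_lt_idxHigh i).le
  exact (lt_or_gt_idx σ⁻¹ i).resolve_right (hcon i (by omega)).not_gt

/-- Commutation of a minuscule dominant weight past the product along a reduced word. -/
theorem mul_prod_of_blockMono {m : (Fin n → ℕ) → E}
    (hstep : ∀ (η : Fin n → ℕ) (i : Idx n), η (idxLow i) = η (idxHigh i) + 1 →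
      m η * T i = (1 + T i) * m (η ∘ simpleT i))
    {ω : Fin n → ℕ} (hω : Antitone ω) (hω₁ : ∀ x, ω x ≤ 1) {w : List (Idx n)}
    {σ : Equiv.Perm (Fin n)} (hw : IsReducedWord w σ) (hσ : BlockMono ω σ) :
    m ω * (w.map T).prod = (w.map fun i => 1 + T i).prod * m (ω ∘ σ) := by
  induction w using List.reverseRecOn generalizing σ with
  | nil =>
    obtain rfl : 1 = σ := hw.1
    simp
  | append_singleton w i ih =>
    obtain ⟨hw', hd⟩ := hw.of_concat
    have hlt : ω (σ (idxHigh i)) = ω (σ (idxLow i)) + 1 := by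
      have h₁ := hω hd.le
      have h₂ := hω₁ (σ (idxHigh i))
      have h₃ : ω (σ (idxHigh i)) ≠ ω (σ (idxLow i)) := fun he => by
        have := hσ _ _ hd he
        rw [← Equiv.Perm.mul_apply, ← Equiv.Perm.mul_apply, inv_mul_cancel] at this
        exact lt_asymm this (idxLow_lt_idxHigh i)
      omega
    have e : (ω ∘ (σ * simpleT i)) ∘ simpleT i = ω ∘ σ := by
      funext x
      simp [simpleT_simpleT]
    rw [List.map_append, List.prod_append, ← mul_assoc, ih hw' (hσ.of_mul hd), mul_assoc,
      List.map_singleton, List.prod_singleton, hstep, e, List.map_append, List.prod_append,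
      List.map_singleton, List.prod_singleton, mul_assoc]
    simpa [simpleT_low, simpleT_high] using hlt

theorem exists_mul_prod_eq {m : (Fin n → ℕ) → E}
    (hcomm : ∀ i j : Idx n, i.1 + 1 < j.1 → T i * T j = T j * T i)
    (hbraid : ∀ i j : Idx n, j.1 = i.1 + 1 → T i * T j * T i = T j * T i * T j)
    (hfix : ∀ (η : Fin n → ℕ) (i : Idx n), η (idxLow i) = η (idxHigh i) →
      m η * T i = T i * m η)
    (hstep : ∀ (η : Fin n → ℕ) (i : Idx n), η (idxLow i) = η (idxHigh i) + 1 →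
      m η * T i = (1 + T i) * m (η ∘ simpleT i))
    {ω : Fin n → ℕ} (hω : Antitone ω) (hω₁ : ∀ x, ω x ≤ 1) {w : List (Idx n)}
    {σ : Equiv.Perm (Fin n)} (hw : IsReducedWord w σ) :
    ∃ a b : List (Idx n), IsReducedWord (a ++ b) σ ∧
      m ω * (w.map T).prod = (a.map T).prod * (b.map fun i => 1 + T i).prod * m (ω ∘ σ) := by
  induction hN : w.length generalizing w σ with
  | zero =>
    obtain rfl := List.length_eq_zero_iff.1 hN
    obtain rfl : 1 = σ := hw.1
    exact ⟨[], [], hw, by simp⟩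
  | succ N ih =>
    by_cases hσ : BlockMono ω σ
    · exact ⟨[], w, hw, by simpa using mul_prod_of_blockMono hstep hω hω₁ hw hσ⟩
    · obtain ⟨i, hi, hd⟩ := exists_descent_of_not_blockMono hω hσ
      obtain ⟨u, hu, hiu⟩ := exists_cons_of_descent hd
      have hlen : (i :: u).length = N + 1 := by
        rw [(isReducedWord_iff.1 hiu).2, ← (isReducedWord_iff.1 hw).2, hN]
      obtain ⟨a, b, hab, he⟩ := ih hu (by simpa using hlen)
      refine ⟨i :: a, b, ?_, ?_⟩
      · rw [isReducedWord_iff] at *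
        refine ⟨?_, ?_⟩
        · rw [List.cons_append, wordProd_cons, hab.1, ← mul_assoc, simpleT_mul_self, one_mul]
        · rw [List.cons_append, List.length_cons, hab.2, ← hu.2, ← hiu.2, List.length_cons]
      · have e : ω ∘ (simpleT i * σ) = ω ∘ σ := by
          funext x
          simp only [Function.comp, Equiv.Perm.mul_apply]
          by_cases h₁ : σ x = idxLow i
          · rw [h₁, simpleT_low, hi]
          by_cases h₂ : σ x = idxHigh i
          · rw [h₂, simpleT_high, hi]
          rw [simpleT_apply_of_ne i h₁ h₂]
        rw [prod_map_eq_of_isReducedWord T hcomm hbraid hw hiu, List.map_cons, List.prod_cons,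
          ← mul_assoc, hfix ω i hi, mul_assoc, he, e, List.map_cons, List.prod_cons]
        simp only [mul_assoc]

end Hecke

/-! ### Divided differences -/

section DividedDiff

variable {n : ℕ} {D : DD n}

theorem sOp_mul (i : Idx n) (f g : MvPolynomial (Fin n) ℤ) :
    sOp i (f * g) = sOp i f * sOp i g := map_mul _ _ _

theorem sOp_sOp (i : Idx n) (f : MvPolynomial (Fin n) ℤ) : sOp i (sOp i f) = f := by
  unfold sOp
  rw [rename_rename]
  have : (simpleT i : Fin n → Fin n) ∘ simpleT i = id := funext (simpleT_simpleT i)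
  rw [this, rename_id_apply]

theorem sOp_X (i : Idx n) (x : Fin n) :
    sOp i (X x) = X (simpleT i x) := rename_X _ _

theorem sOp_simpleT_mul {i j : Idx n} (f : MvPolynomial (Fin n) ℤ) :
    sOp i (sOp j f) = rename (simpleT i * simpleT j : Equiv.Perm (Fin n)) f :=
  rename_rename _ _ _

theorem X_low_sub_X_high_ne_zero (i : Idx n) :
    (X (idxLow i) - X (idxHigh i) : MvPolynomial (Fin n) ℤ) ≠ 0 :=
  sub_ne_zero.2 fun h => (idxLow_lt_idxHigh i).ne (X_injective h)

theorem IsDividedDiff.eq_of_mul_eq (hD : IsDividedDiff D) {i : Idx n}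
    {f g : MvPolynomial (Fin n) ℤ}
    (h : (X (idxLow i) - X (idxHigh i)) * g = f - sOp i f) : D i f = g :=
  mul_left_cancel₀ (X_low_sub_X_high_ne_zero i) ((hD i f).trans h.symm)

theorem IsDividedDiff.map_add (hD : IsDividedDiff D) (i : Idx n)
    (f g : MvPolynomial (Fin n) ℤ) : D i (f + g) = D i f + D i g := by
  refine hD.eq_of_mul_eq ?_
  have : sOp i (f + g) = sOp i f + sOp i g := _root_.map_add _ _ _
  rw [this, mul_add, hD, hD]
  ring

theorem IsDividedDiff.mul_of_sOp_eq (hD : IsDividedDiff D) {i : Idx n}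
    {f : MvPolynomial (Fin n) ℤ} (hf : sOp i f = f) (g : MvPolynomial (Fin n) ℤ) :
    D i (f * g) = f * D i g := by
  refine hD.eq_of_mul_eq ?_
  rw [sOp_mul, hf]
  linear_combination f * hD i g

theorem IsDividedDiff.eq_zero_of_sOp_eq (hD : IsDividedDiff D) {i : Idx n}
    {f : MvPolynomial (Fin n) ℤ} (hf : sOp i f = f) : D i f = 0 :=
  hD.eq_of_mul_eq (by rw [hf, mul_zero, sub_self])

theorem IsDividedDiff.sOp_piOp (hD : IsDividedDiff D) (i : Idx n)
    (f : MvPolynomial (Fin n) ℤ) : sOp i (piOp D i f) = piOp D i f := by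
  have h := hD i (X (idxLow i) * f)
  have h' := congrArg (sOp i) h
  have e : ∀ p q : MvPolynomial (Fin n) ℤ, sOp i (p - q) = sOp i p - sOp i q :=
    fun p q => map_sub _ p q
  rw [sOp_mul, e, e, sOp_X, sOp_X, simpleT_low, simpleT_high, sOp_sOp] at h'
  refine mul_left_cancel₀ (X_low_sub_X_high_ne_zero i) ?_
  unfold piOp
  linear_combination -h' - h

theorem IsDividedDiff.piOp_eq (hD : IsDividedDiff D) (i : Idx n)
    (f : MvPolynomial (Fin n) ℤ) : piOp D i f = f + thetaOp D i f := by
  refine hD.eq_of_mul_eq ?_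
  unfold thetaOp
  rw [sOp_mul, sOp_X, simpleT_low]
  linear_combination X (idxHigh i) * hD i f

theorem IsDividedDiff.theta_mul_sub (hD : IsDividedDiff D) (i : Idx n)
    (f : MvPolynomial (Fin n) ℤ) :
    (X (idxLow i) - X (idxHigh i)) * thetaOp D i f = X (idxHigh i) * (f - sOp i f) := by
  unfold thetaOp
  linear_combination X (idxHigh i) * hD i f

theorem addEnd_mul_apply {A : Type*} [AddCommMonoid A] (f g : AddMonoid.End A) (x : A) :
    (f * g) x = f (g x) := rfl

/-- `θ_i` as an additive endomorphism. -/
noncomputable def thetaEnd (hD : IsDividedDiff D) (i : Idx n) :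
    AddMonoid.End (MvPolynomial (Fin n) ℤ) :=
  AddMonoidHom.mk' (thetaOp D i) fun f g => by
    unfold thetaOp
    rw [hD.map_add, mul_add]

theorem thetaEnd_apply (hD : IsDividedDiff D) (i : Idx n) (f : MvPolynomial (Fin n) ℤ) :
    thetaEnd hD i f = thetaOp D i f := rfl

theorem one_add_thetaEnd_apply (hD : IsDividedDiff D) (i : Idx n)
    (f : MvPolynomial (Fin n) ℤ) : (1 + thetaEnd hD i) f = piOp D i f :=
  (hD.piOp_eq i f).symm

theorem thetaWord_eq (hD : IsDividedDiff D) (w : List (Idx n)) (f : MvPolynomial (Fin n) ℤ) :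
    thetaWord D w f = (w.map (thetaEnd hD)).prod f := by
  induction w with
  | nil => rfl
  | cons i w ih =>
    rw [List.map_cons, List.prod_cons, addEnd_mul_apply, ← ih]
    rfl

theorem piWord_eq (hD : IsDividedDiff D) (w : List (Idx n)) (f : MvPolynomial (Fin n) ℤ) :
    piWord D w f = (w.map fun i => 1 + thetaEnd hD i).prod f := by
  induction w with
  | nil => rfl
  | cons i w ih =>
    rw [List.map_cons, List.prod_cons, addEnd_mul_apply, ← ih, one_add_thetaEnd_apply]
    rfl

theorem thetaEnd_sq (hD : IsDividedDiff D) (i : Idx n) :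
    thetaEnd hD i * thetaEnd hD i = -thetaEnd hD i := by
  ext1 f
  have h := hD.eq_zero_of_sOp_eq (hD.sOp_piOp i f)
  have h₁ : thetaOp D i (piOp D i f) = 0 := by rw [thetaOp, h, mul_zero]
  rw [← one_add_thetaEnd_apply hD, ← thetaEnd_apply hD, ← addEnd_mul_apply, mul_add,
    mul_one] at h₁
  exact eq_neg_of_add_eq_zero_right h₁

theorem thetaEnd_comm (hD : IsDividedDiff D) (i j : Idx n) (hij : i.1 + 1 < j.1) :
    thetaEnd hD i * thetaEnd hD j = thetaEnd hD j * thetaEnd hD i := by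
  ext1 f
  simp only [addEnd_mul_apply, thetaEnd_apply]
  have f₁ : ∀ x : Fin n, x.1 = i.1 ∨ x.1 = i.1 + 1 → sOp j (X x) = X x := fun x hx => by
    rw [sOp_X, simpleT_apply_of_ne] <;>
      simp only [idxLow, idxHigh, ne_eq, Fin.ext_iff] <;> omega
  have f₂ : ∀ x : Fin n, x.1 = j.1 ∨ x.1 = j.1 + 1 → sOp i (X x) = X x := fun x hx => by
    rw [sOp_X, simpleT_apply_of_ne] <;>
      simp only [idxLow, idxHigh, ne_eq, Fin.ext_iff] <;> omega
  have e : ∀ k (p q : MvPolynomial (Fin n) ℤ), sOp k (p - q) = sOp k p - sOp k q :=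
    fun k p q => map_sub _ p q
  have h₁ := hD.theta_mul_sub i (thetaOp D j f)
  have h₂ := hD.theta_mul_sub j (thetaOp D i f)
  have h₃ := hD.theta_mul_sub i f
  have h₄ := hD.theta_mul_sub j f
  have h₃' := congrArg (sOp j) h₃
  have h₄' := congrArg (sOp i) h₄
  simp only [sOp_mul, e] at h₃' h₄'
  rw [f₁ _ (Or.inl rfl), f₁ _ (Or.inr rfl)] at h₃'
  rw [f₂ _ (Or.inl rfl), f₂ _ (Or.inr rfl)] at h₄'
  have hs : sOp i (sOp j f) = sOp j (sOp i f) := by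
    rw [sOp_simpleT_mul, sOp_simpleT_mul, simpleT_comm hij]
  refine mul_left_cancel₀ (mul_ne_zero (X_low_sub_X_high_ne_zero i)
    (X_low_sub_X_high_ne_zero j)) ?_
  rw [hs] at h₄'
  linear_combination (X (idxLow j) - X (idxHigh j)) * h₁ - (X (idxLow i) - X (idxHigh i)) * h₂
    + X (idxHigh i) * (h₄ - h₄') - X (idxHigh j) * (h₃ - h₃')

theorem thetaEnd_braid (hD : IsDividedDiff D) (i j : Idx n) (hij : j.1 = i.1 + 1) :
    thetaEnd hD i * thetaEnd hD j * thetaEnd hD i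
      = thetaEnd hD j * thetaEnd hD i * thetaEnd hD j := by
  ext1 f
  simp only [addEnd_mul_apply, thetaEnd_apply]
  have e₀ : idxHigh i = idxLow j := by simp [idxHigh, idxLow, hij]
  have sub : ∀ k (p q : MvPolynomial (Fin n) ℤ), sOp k (p - q) = sOp k p - sOp k q :=
    fun k p q => map_sub _ p q
  have ia : sOp i (X (idxLow i)) = X (idxHigh i) := by rw [sOp_X, simpleT_low]
  have ib : sOp i (X (idxHigh i)) = X (idxLow i) := by rw [sOp_X, simpleT_high]
  have jb : sOp j (X (idxHigh i)) = X (idxHigh j) := by rw [sOp_X, e₀, simpleT_low]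
  have jc : sOp j (X (idxHigh j)) = X (idxHigh i) := by rw [sOp_X, e₀, simpleT_high]
  have ic : sOp i (X (idxHigh j)) = X (idxHigh j) := by
    rw [sOp_X, simpleT_apply_of_ne] <;>
      simp only [idxLow, idxHigh, ne_eq, Fin.ext_iff] <;> omega
  have ja : sOp j (X (idxLow i)) = X (idxLow i) := by
    rw [sOp_X, simpleT_apply_of_ne] <;>
      simp only [idxLow, idxHigh, ne_eq, Fin.ext_iff] <;> omega
  have hs : sOp i (sOp j (sOp i f)) = sOp j (sOp i (sOp j f)) := by
    simp only [sOp, rename_rename, ← Equiv.Perm.coe_mul, ← mul_assoc, simpleT_braid hij]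
  have hab := X_low_sub_X_high_ne_zero i
  have hbc := X_low_sub_X_high_ne_zero j
  have hac : (X (idxLow i) - X (idxHigh j) : MvPolynomial (Fin n) ℤ) ≠ 0 :=
    sub_ne_zero.2 fun h =>
      ((idxLow_lt_idxHigh i).trans (e₀ ▸ idxLow_lt_idxHigh j)).ne (X_injective h)
  have i₁ := hD.theta_mul_sub i f
  have j₁ := hD.theta_mul_sub j f
  have j₂ := hD.theta_mul_sub j (thetaOp D i f)
  have i₂ := hD.theta_mul_sub i (thetaOp D j f)
  have i₃ := hD.theta_mul_sub i (thetaOp D j (thetaOp D i f))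
  have j₃ := hD.theta_mul_sub j (thetaOp D i (thetaOp D j f))
  have ji₁ := congrArg (sOp j) i₁
  have ij₁ := congrArg (sOp i) j₁
  have ij₂ := congrArg (sOp i) j₂
  have ji₂ := congrArg (sOp j) i₂
  have iji₁ := congrArg (sOp i) ji₁
  have jij₁ := congrArg (sOp j) ij₁
  have ii₁ := congrArg (sOp i) i₁
  have jj₁ := congrArg (sOp j) j₁
  rw [← e₀] at *
  simp only [sOp_mul, sub, ia, ib, ic, ja, jb, jc, sOp_sOp] at ji₁ ij₁ ij₂ ji₂ iji₁ jij₁ ii₁ jj₁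
  rw [← hs] at jij₁
  generalize thetaOp D i (thetaOp D j (thetaOp D i f)) = k₁ at *
  generalize thetaOp D j (thetaOp D i (thetaOp D j f)) = k₂ at *
  generalize (X (idxLow i) : MvPolynomial (Fin n) ℤ) = a at *
  generalize (X (idxHigh i) : MvPolynomial (Fin n) ℤ) = b at *
  generalize (X (idxHigh j) : MvPolynomial (Fin n) ℤ) = c at *
  have h₁ : (a - b) * ((a - b) * (b - c) * (a - c)) * k₁
      = (a - b) * (b * c ^ 2 * (f - sOp i f - sOp j f + sOp j (sOp i f) + sOp i (sOp j f)
        - sOp i (sOp j (sOp i f)))) := by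
    linear_combination (a - b) * (b - c) * (a - c) * i₃ + b * (a - b) * (a - c) * j₂
      - b * (a - b) * (b - c) * ij₂ + b * c * (a - c) * i₁ - b * c * (a - b) * ji₁
      + b * c * (b - c) * ii₁ + b * c * (a - b) * iji₁
  have h₂ : (b - c) * ((a - b) * (b - c) * (a - c)) * k₂
      = (b - c) * (b * c ^ 2 * (f - sOp i f - sOp j f + sOp j (sOp i f) + sOp i (sOp j f)
        - sOp i (sOp j (sOp i f)))) := by
    linear_combination (a - b) * (b - c) * (a - c) * j₃ + c * (b - c) * (a - c) * i₂
      - c * (b - c) * (a - b) * ji₂ + b * c * (a - c) * j₁ - b * c * (b - c) * ij₁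
      + c ^ 2 * (a - b) * jj₁ + c ^ 2 * (b - c) * jij₁
  refine mul_left_cancel₀ (mul_ne_zero (mul_ne_zero hab hbc)
    (mul_ne_zero (mul_ne_zero hab hbc) hac)) ?_
  linear_combination (b - c) * h₁ - (a - b) * h₂


/-! ### Monomials -/

theorem xpow_zero : xpow (0 : Fin n → ℕ) = 1 := by simp [xpow]

theorem xpow_add (η ν : Fin n → ℕ) : xpow (η + ν) = xpow η * xpow ν := by
  simp [xpow, pow_add, Finset.prod_mul_distrib]

theorem xpow_single (x : Fin n) : xpow (Pi.single x 1) = X x := by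
  unfold xpow
  rw [Finset.prod_eq_single x] <;> simp +contextual

theorem sOp_xpow (i : Idx n) (η : Fin n → ℕ) : sOp i (xpow η) = xpow (η ∘ simpleT i) := by
  unfold sOp xpow
  rw [map_prod]
  simp only [map_pow, rename_X]
  exact Fintype.prod_equiv (simpleT i) _ _ fun x => by simp [simpleT_simpleT]

theorem comp_simpleT_eq {i : Idx n} {η : Fin n → ℕ} (h : η (idxLow i) = η (idxHigh i)) :
    η ∘ simpleT i = η := by
  funext x
  rw [Function.comp]
  by_cases h₁ : x = idxLow i
  · rw [h₁, simpleT_low, h]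
  by_cases h₂ : x = idxHigh i
  · rw [h₂, simpleT_high, h]
  rw [simpleT_apply_of_ne i h₁ h₂]

/-- Multiplication by a monomial as an additive endomorphism. -/
noncomputable def xpowEnd (η : Fin n → ℕ) : AddMonoid.End (MvPolynomial (Fin n) ℤ) :=
  AddMonoidHom.mulLeft (xpow η)

theorem xpowEnd_apply (η : Fin n → ℕ) (f : MvPolynomial (Fin n) ℤ) :
    xpowEnd η f = xpow η * f := rfl

theorem xpowEnd_mul_thetaEnd_of_eq (hD : IsDividedDiff D) (η : Fin n → ℕ) (i : Idx n)
    (h : η (idxLow i) = η (idxHigh i)) :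
    xpowEnd η * thetaEnd hD i = thetaEnd hD i * xpowEnd η := by
  ext1 f
  simp only [addEnd_mul_apply, thetaEnd_apply, xpowEnd_apply, thetaOp]
  rw [hD.mul_of_sOp_eq (by rw [sOp_xpow, comp_simpleT_eq h])]
  ring

theorem xpowEnd_mul_thetaEnd_of_succ (hD : IsDividedDiff D) (η : Fin n → ℕ) (i : Idx n)
    (h : η (idxLow i) = η (idxHigh i) + 1) :
    xpowEnd η * thetaEnd hD i = (1 + thetaEnd hD i) * xpowEnd (η ∘ simpleT i) := by
  have hne := (idxLow_lt_idxHigh i).ne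
  have e : Pi.single (idxLow i) 1 + η ∘ simpleT i = Pi.single (idxHigh i) 1 + η := by
    funext x
    simp only [Pi.add_apply, Function.comp, Pi.single_apply]
    by_cases h₁ : x = idxLow i
    · rw [h₁, simpleT_low, if_pos rfl, if_neg hne]
      omega
    by_cases h₂ : x = idxHigh i
    · rw [h₂, simpleT_high, if_pos rfl, if_neg hne.symm]
      omega
    rw [simpleT_apply_of_ne i h₁ h₂, if_neg h₁, if_neg h₂]
  have e' : X (idxLow i) * xpow (η ∘ simpleT i) = X (idxHigh i) * xpow η := by
    rw [← xpow_single, ← xpow_single, ← xpow_add, ← xpow_add, e]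
  ext1 f
  simp only [addEnd_mul_apply, one_add_thetaEnd_apply, xpowEnd_apply, thetaEnd_apply, piOp, thetaOp]
  rw [← mul_assoc (X (idxLow i)), e', hD.mul_of_sOp_eq]
  · ring
  · rw [sOp_mul, sOp_X, simpleT_high, sOp_xpow, e']

/-! ### Atom positivity -/

theorem atomPos_of_mem_heckeCone (hD : IsDividedDiff D)
    {x : AddMonoid.End (MvPolynomial (Fin n) ℤ)} (hx : x ∈ heckeCone (thetaEnd hD))
    {ν : Fin n → ℕ} (hν : Antitone ν) : AtomPos D (x (xpow ν)) := by
  induction hx using AddSubmonoid.closure_induction with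
  | mem x hx =>
    obtain ⟨w, σ, hw, rfl⟩ := hx
    exact AddSubmonoid.subset_closure ⟨w, σ, ν, hw, hν, (thetaWord_eq hD w _).symm⟩
  | zero => exact zero_mem _
  | add x y _ _ hx hy => exact add_mem hx hy

theorem AtomPos.piOp (hD : IsDividedDiff D) {f : MvPolynomial (Fin n) ℤ} (hf : AtomPos D f)
    (i : Idx n) : AtomPos D (piOp D i f) := by
  rw [← one_add_thetaEnd_apply hD]
  induction hf using AddSubmonoid.closure_induction with
  | mem x hx =>
    obtain ⟨w, σ, ν, hw, hν, rfl⟩ := hx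
    rw [thetaWord_eq hD, ← addEnd_mul_apply]
    exact atomPos_of_mem_heckeCone hD (one_add_mul_mem_heckeCone (thetaEnd_comm hD)
      (thetaEnd_braid hD) (thetaEnd_sq hD) (prod_mem_heckeCone hw) i) hν
  | zero => rw [map_zero]; exact zero_mem _
  | add x y _ _ hx hy => rw [map_add]; exact add_mem hx hy

theorem AtomPos.piWord (hD : IsDividedDiff D) {f : MvPolynomial (Fin n) ℤ} (hf : AtomPos D f)
    (w : List (Idx n)) : AtomPos D (piWord D w f) := by
  induction w with
  | nil => exact hf
  | cons i w ih => exact ih.piOp hD i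

theorem atomPos_xpow {ν : Fin n → ℕ} (hν : Antitone ν) : AtomPos D (xpow ν) :=
  AddSubmonoid.subset_closure
    ⟨[], 1, ν, isReducedWord_iff.2 ⟨rfl, invNum_one.symm⟩, hν, rfl⟩

/-- Either an atom vanishes, or the weight of `ω` transported by `σ` stays dominant. -/
theorem thetaWord_eq_zero_or_antitone (hD : IsDividedDiff D) {ω ν : Fin n → ℕ}
    (hω : Antitone ω) (hω₁ : ∀ x, ω x ≤ 1) (hν : Antitone ν) {w : List (Idx n)}
    {σ : Equiv.Perm (Fin n)} (hw : IsReducedWord w σ) :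
    (w.map (thetaEnd hD)).prod (xpow ν) = 0 ∨ Antitone (ω ∘ σ + ν) := by
  by_cases hdom : ∀ i : Idx n, (ω ∘ σ + ν) (idxHigh i) ≤ (ω ∘ σ + ν) (idxLow i)
  · right
    intro x y hxy
    rcases hxy.eq_or_lt with rfl | hxy
    · exact le_rfl
    · exact rel_of_adjacent (fun x y => (ω ∘ σ + ν) y ≤ (ω ∘ σ + ν) x)
        (fun _ _ _ h₁ h₂ => h₂.trans h₁) hxy fun i _ _ => hdom i
  · left
    push Not at hdom
    obtain ⟨i, hi⟩ := hdom
    simp only [Pi.add_apply, Function.comp] at hi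
    have h₁ := hν (idxLow_lt_idxHigh i).le
    have h₂ := hω₁ (σ (idxHigh i))
    have hd : σ (idxHigh i) < σ (idxLow i) := by
      refine (lt_or_gt_idx σ i).resolve_left fun h => ?_
      have := hω h.le
      omega
    obtain ⟨u, -, hu⟩ := exists_concat_of_descent hd
    have hz : thetaEnd hD i (xpow ν) = 0 := by
      rw [thetaEnd_apply, thetaOp, hD.eq_zero_of_sOp_eq, mul_zero]
      rw [sOp_xpow, comp_simpleT_eq (by omega)]
    rw [prod_map_eq_of_isReducedWord _ (thetaEnd_comm hD) (thetaEnd_braid hD) hw hu,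
      List.map_append, List.prod_append, addEnd_mul_apply, List.map_singleton,
      List.prod_singleton, hz, map_zero]

theorem AtomPos.xpow_mul_of_le_one (hD : IsDividedDiff D) {f : MvPolynomial (Fin n) ℤ}
    (hf : AtomPos D f) {ω : Fin n → ℕ} (hω : Antitone ω) (hω₁ : ∀ x, ω x ≤ 1) :
    AtomPos D (xpow ω * f) := by
  induction hf using AddSubmonoid.closure_induction with
  | mem x hx =>
    obtain ⟨w, σ, ν, hw, hν, rfl⟩ := hx
    rw [thetaWord_eq hD]
    rcases thetaWord_eq_zero_or_antitone hD hω hω₁ hν hw with h | h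
    · rw [h, mul_zero]
      exact zero_mem _
    · obtain ⟨a, b, hab, he⟩ := exists_mul_prod_eq (thetaEnd_comm hD) (thetaEnd_braid hD)
        (xpowEnd_mul_thetaEnd_of_eq hD) (xpowEnd_mul_thetaEnd_of_succ hD) hω hω₁ hw
      rw [← xpowEnd_apply, ← addEnd_mul_apply, he, addEnd_mul_apply, xpowEnd_apply, ← xpow_add]
      exact atomPos_of_mem_heckeCone hD (mul_prod_one_add_mem_heckeCone (thetaEnd_comm hD)
        (thetaEnd_braid hD) (thetaEnd_sq hD) (prod_mem_heckeCone hab.of_append) b) h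
  | zero => rw [mul_zero]; exact zero_mem _
  | add x y _ _ hx hy => rw [mul_add]; exact add_mem hx hy

/-- The product of a dominant monomial and an atom-positive polynomial is atom-positive. -/
theorem AtomPos.xpow_mul (hD : IsDividedDiff D) {f : MvPolynomial (Fin n) ℤ}
    (hf : AtomPos D f) {μ : Fin n → ℕ} (hμ : Antitone μ) : AtomPos D (xpow μ * f) := by
  induction hN : ∑ x, μ x using Nat.strong_induction_on generalizing μ with
  | _ N ih =>
  by_cases h0 : μ = 0
  · rw [h0, xpow_zero, one_mul]
    exact hf
  · have e : μ = (fun x => min (μ x) 1) + fun x => μ x - 1 := by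
      funext x
      simp only [Pi.add_apply]
      omega
    rw [e, xpow_add, mul_assoc]
    refine (ih _ ?_ (fun x y hxy => Nat.sub_le_sub_right (hμ hxy) 1) rfl).xpow_mul_of_le_one hD
      (fun x y hxy => min_le_min_right 1 (hμ hxy)) fun x => min_le_right _ _
    obtain ⟨x, hx⟩ := Function.ne_iff.1 h0
    rw [← hN]
    refine Finset.sum_lt_sum (fun x _ => Nat.sub_le _ _) ⟨x, Finset.mem_univ _, ?_⟩
    exact Nat.sub_lt (Nat.pos_of_ne_zero hx) one_pos

theorem sOp_piWord_revPerm (hD : IsDividedDiff D) {r : List (Idx n)}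
    (hr : IsReducedWord r (Fin.revPerm : Equiv.Perm (Fin n))) (f : MvPolynomial (Fin n) ℤ)
    (i : Idx n) : sOp i (piWord D r f) = piWord D r f := by
  have hd : (Fin.revPerm : Equiv.Perm (Fin n))⁻¹ (idxHigh i)
      < (Fin.revPerm : Equiv.Perm (Fin n))⁻¹ (idxLow i) :=
    Fin.rev_lt_rev.2 (idxLow_lt_idxHigh i)
  obtain ⟨u, -, hu⟩ := exists_cons_of_descent hd
  rw [piWord_eq hD, prod_map_eq_of_isReducedWord _ (one_add_comm (thetaEnd_comm hD))
    (one_add_braid (thetaEnd_braid hD) (thetaEnd_sq hD)) hr hu, List.map_cons, List.prod_cons,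
    addEnd_mul_apply, one_add_thetaEnd_apply, hD.sOp_piOp]

theorem piWord_mul_of_symmetric (hD : IsDividedDiff D) {s : MvPolynomial (Fin n) ℤ}
    (hs : ∀ i, sOp i s = s) (w : List (Idx n)) (f : MvPolynomial (Fin n) ℤ) :
    piWord D w (f * s) = piWord D w f * s := by
  induction w with
  | nil => rfl
  | cons i w ih =>
    simp only [piWord, piOp, ih]
    rw [← mul_assoc, mul_comm _ s, hD.mul_of_sOp_eq (hs i), mul_comm]

end DividedDiff

/-- the product of a key polynomial and a Schur polynomial is
atom-positive. -/
theorem stmt18 (n : ℕ) (D : DD n) (hD : IsDividedDiff D)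
    (lam mu : Fin n → ℕ) (hlam : Antitone lam) (hmu : Antitone mu)
    (I r : List (Idx n))
    (hr : IsReducedWord r (Fin.revPerm : Equiv.Perm (Fin n))) :
    AtomPos D (piWord D I (xpow mu) * piWord D r (xpow lam)) := by
  rw [← piWord_mul_of_symmetric hD (sOp_piWord_revPerm hD hr _)]
  exact (((atomPos_xpow hlam).piWord hD r).xpow_mul hD hmu).piWord hD I
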